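/- Suppose Y: ℝⁿ → ℝ is C^{q+1} on a ball B_{R+1}, K ⊂ B_R is compact, ‖∇Y‖_{C^q(B_{R+1})} ≤ M, and Σ_{|α|≤q} |∂^α Y(x)| ≥ 1 for all x ∈ K, where q ≥ 1 is an integer. Then for every ε ∈ (0,1], the Lebesgue measure of {x ∈ K : |Y(x)| ≤ ε} is at most C(n,q,R,M)·ε^{1/q}. -/

import Mathlib

open MeasureTheory

section Symmetry

variable {E F : Type*} [NormedAddCommGroup E] [NormedSpace ℝ E]
  [NormedAddCommGroup F] [NormedSpace ℝ F]

/-- The iterated derivative of a `C^{n+1}` function is invariant under adjacent transpositions. -/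
theorem ContDiffAt.iteratedFDeriv_comp_swap_castSucc_succ {f : E → F} :
    ∀ {n : ℕ} (i : Fin n) {x : E}, ContDiffAt ℝ (n + 1) f x → ∀ v : Fin (n + 1) → E,
      iteratedFDeriv ℝ (n + 1) f x (v ∘ Equiv.swap i.castSucc i.succ) =
        iteratedFDeriv ℝ (n + 1) f x v := by
  intro n
  induction n with
  | zero => exact fun i => i.elim0
  | succ n ih =>
    intro i x hf v
    have hd : DifferentiableAt ℝ (iteratedFDeriv ℝ (n + 1) f) x :=
      hf.differentiableAt_iteratedFDeriv (by norm_cast; omega)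
    refine Fin.cases ?_ (fun j => ?_) i
    · have hs : ContDiffAt ℝ 2 (iteratedFDeriv ℝ n f) x :=
        hf.iteratedFDeriv_right (by norm_cast; omega)
      have key : ∀ w : Fin (n + 2) → E, iteratedFDeriv ℝ (n + 2) f x w =
          fderiv ℝ (fderiv ℝ (iteratedFDeriv ℝ n f)) x (w 0) (w 1) (Fin.tail (Fin.tail w)) := by
        intro w
        have hd' : HasFDerivAt (fderiv ℝ (iteratedFDeriv ℝ n f)) _ x :=
          ((hs.fderiv_right (m := 1) (by norm_num)).differentiableAt one_ne_zero).hasFDerivAt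
        have h := (((ContinuousMultilinearMap.apply ℝ (fun _ : Fin n => E) F
          (Fin.tail (Fin.tail w))).comp
            (ContinuousLinearMap.apply ℝ _ (w 1))).hasFDerivAt.comp x hd').fderiv
        rw [hd.iteratedFDeriv_succ_apply_left']
        exact congrArg (fun L => L (w 0)) h
      have hsymm := hs.isSymmSndFDerivAt (by simp)
      rw [key, key, hsymm (v 0) (v 1)]
      have h0 : (v ∘ Equiv.swap (0 : Fin (n + 1)).castSucc (0 : Fin (n + 1)).succ) 0 = v 1 := by
        simp
      have h1 : (v ∘ Equiv.swap (0 : Fin (n + 1)).castSucc (0 : Fin (n + 1)).succ) 1 = v 0 := by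
        simp
      have h2 : Fin.tail (Fin.tail (v ∘ Equiv.swap (0 : Fin (n + 1)).castSucc
          (0 : Fin (n + 1)).succ)) = Fin.tail (Fin.tail v) := by
        funext k
        simp only [Fin.tail, Function.comp_apply]
        rw [Equiv.swap_apply_of_ne_of_ne]
        · simp [Fin.ext_iff]
        · simp [Fin.ext_iff]
      rw [h0, h1, h2]
    · have h0 : (v ∘ Equiv.swap j.succ.castSucc j.succ.succ) 0 = v 0 := by
        simp only [Function.comp_apply]
        rw [Equiv.swap_apply_of_ne_of_ne] <;> simp [Fin.ext_iff]
      have h1 : Fin.tail (v ∘ Equiv.swap j.succ.castSucc j.succ.succ) =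
          Fin.tail v ∘ Equiv.swap j.castSucc j.succ := by
        funext k
        simp only [Fin.tail, Function.comp_apply]
        rw [← Fin.succ_castSucc, (Fin.succ_injective _).swap_apply]
      rw [hd.iteratedFDeriv_succ_apply_left', hd.iteratedFDeriv_succ_apply_left', h0, h1]
      have hev : (fun y => iteratedFDeriv ℝ (n + 1) f y (Fin.tail v ∘ Equiv.swap j.castSucc j.succ))
          =ᶠ[nhds x] fun y => iteratedFDeriv ℝ (n + 1) f y (Fin.tail v) := by
        have h' : ContDiffAt ℝ (n + 1) f x := hf.of_le (by norm_cast; omega)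
        have hne : ((n : WithTop ℕ∞) + 1) ≠ ((⊤ : ℕ∞) : WithTop ℕ∞) := by
          exact_mod_cast ENat.natCast_ne_top (n + 1)
        filter_upwards [h'.eventually hne] with y hy
        exact ih j hy _
      rw [hev.fderiv_eq]

/-- The `n`-th iterated derivative of a real `C^n` function is symmetric. -/
theorem ContDiffAt.iteratedFDeriv_comp_perm_of_le {f : E → F} {n : ℕ} {x : E}
    (hf : ContDiffAt ℝ n f x) (v : Fin n → E) (σ : Equiv.Perm (Fin n)) :
    iteratedFDeriv ℝ n f x (v ∘ σ) = iteratedFDeriv ℝ n f x v := by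
  cases n with
  | zero => congr 1; exact Subsingleton.elim _ _
  | succ n =>
    have hσ : σ ∈ Submonoid.closure
        (Set.range fun i : Fin n => Equiv.swap i.castSucc i.succ) := by
      rw [Equiv.Perm.mclosure_swap_castSucc_succ]; trivial
    induction hσ using Submonoid.closure_induction generalizing v with
    | mem τ hτ =>
      obtain ⟨i, rfl⟩ := hτ
      exact ContDiffAt.iteratedFDeriv_comp_swap_castSucc_succ i (by exact_mod_cast hf) v
    | one => rfl
    | mul σ τ _ _ hσ hτ =>
      rw [Equiv.Perm.coe_mul, ← Function.comp_assoc, hτ, hσ]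

end Symmetry

section Polarization

variable {E : Type*} [NormedAddCommGroup E] [NormedSpace ℝ E]

open Finset in
/-- Inclusion-exclusion form of the polarization identity, before using symmetry. -/
theorem ContinuousMultilinearMap.sum_surjective_eq {n : ℕ}
    (A : ContinuousMultilinearMap ℝ (fun _ : Fin n => E) ℝ) (v : Fin n → E) :
    ∑ r : Fin n → Fin n with Function.Surjective r, A (v ∘ r) =
      ∑ t : Finset (Fin n), (-1) ^ #t * A fun _ => ∑ j ∈ tᶜ, v j := by
  classical
  have h := Finset.inclusion_exclusion_sum_inf_compl (univ : Finset (Fin n))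
    (fun i => univ.filter fun r : Fin n → Fin n => ∀ k, r k ≠ i) (fun r => A (v ∘ r))
  rw [powerset_univ] at h
  convert h using 2
  · ext r
    simp only [mem_filter_univ, Finset.mem_inf, mem_compl, mem_univ, forall_true_left, not_forall,
      not_not]
    rfl
  · rename_i t _
    rw [A.map_sum_finset]
    simp only [zsmul_eq_mul, Int.cast_pow, Int.cast_neg, Int.cast_one]
    congr 2
    ext r
    simp only [Fintype.mem_piFinset, Finset.mem_inf, mem_filter_univ, mem_compl]
    exact ⟨fun h i hi k hk => h k (hk ▸ hi), fun h k hk => h _ hk k rfl⟩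

/-- The norm of a symmetric multilinear form is controlled by its values on the diagonal. -/
theorem ContinuousMultilinearMap.norm_le_of_diagonal_le {n : ℕ} (hn : 1 ≤ n)
    (A : ContinuousMultilinearMap ℝ (fun _ : Fin n => E) ℝ)
    (hA : ∀ (v : Fin n → E) (σ : Equiv.Perm (Fin n)), A (v ∘ σ) = A v) {η : ℝ}
    (hη : ∀ w : E, ‖w‖ ≤ 1 → |A fun _ => w| ≤ η) : ‖A‖ ≤ (2 * n) ^ n * η := by
  classical
  have hn0 : (0 : ℝ) < n := by exact_mod_cast hn
  have hη0 : 0 ≤ η := (abs_nonneg _).trans (hη 0 (by simp))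
  have hdiag : ∀ w : E, ‖w‖ ≤ n → |A fun _ => w| ≤ n ^ n * η := by
    intro w hw
    have e : (fun _ : Fin n => w) = fun _ => (n : ℝ) • ((n : ℝ)⁻¹ • w) := by
      funext _; rw [smul_inv_smul₀ hn0.ne']
    rw [e, A.map_smul_univ (fun _ => (n : ℝ)) (fun _ => (n : ℝ)⁻¹ • w)]
    simp only [Finset.prod_const, Finset.card_univ, Fintype.card_fin, smul_eq_mul, abs_mul, abs_pow,
      Nat.abs_cast]
    gcongr
    apply hη
    rw [norm_smul, norm_inv, Real.norm_natCast, inv_mul_le_iff₀ hn0]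
    simpa using hw
  have hunit : ∀ v : Fin n → E, (∀ j, ‖v j‖ ≤ 1) → |A v| ≤ (2 * n) ^ n * η := by
    intro v hv
    have h := A.sum_surjective_eq v
    have h1 : ∑ r : Fin n → Fin n with Function.Surjective r, A (v ∘ r) =
        (Finset.univ.filter fun r : Fin n → Fin n => Function.Surjective r).card * A v := by
      rw [Finset.sum_congr rfl (g := fun _ => A v), Finset.sum_const, nsmul_eq_mul]
      intro r hr
      have hr' : Function.Surjective r := by simpa using hr
      exact hA v (Equiv.ofBijective r (Finite.surjective_iff_bijective.1 hr'))
    have hcard : 1 ≤ (Finset.univ.filter fun r : Fin n → Fin n => Function.Surjective r).card :=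
      Finset.card_pos.2 ⟨id, by simp [Function.surjective_id]⟩
    have hcard' : (1 : ℝ) ≤
        (Finset.univ.filter fun r : Fin n → Fin n => Function.Surjective r).card := by
      exact_mod_cast hcard
    calc |A v| ≤ (Finset.univ.filter fun r : Fin n → Fin n => Function.Surjective r).card * |A v| :=
          le_mul_of_one_le_left (abs_nonneg _) hcard'
      _ = |∑ t : Finset (Fin n), (-1) ^ t.card * A fun _ => ∑ j ∈ tᶜ, v j| := by
          rw [← h, h1, abs_mul, Nat.abs_cast]
      _ ≤ ∑ t : Finset (Fin n), |(-1) ^ t.card * A fun _ => ∑ j ∈ tᶜ, v j| :=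
          Finset.abs_sum_le_sum_abs _ _
      _ ≤ ∑ t : Finset (Fin n), (n : ℝ) ^ n * η := by
          refine Finset.sum_le_sum fun t _ => ?_
          rw [abs_mul, abs_pow, abs_neg, abs_one, one_pow, one_mul]
          refine hdiag _ ((norm_sum_le_of_le _ fun j _ => hv j).trans ?_)
          simpa using (Finset.card_le_univ tᶜ)
      _ = (2 * n) ^ n * η := by
          simp [mul_pow, mul_assoc]
  refine A.opNorm_le_bound (by positivity) fun m => ?_
  have e : m = fun j => ‖m j‖ • (‖m j‖⁻¹ • m j) := by
    funext j
    by_cases h : m j = 0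
    · simp [h]
    · rw [smul_inv_smul₀ (norm_ne_zero_iff.2 h)]
  have hm : |A fun j => ‖m j‖⁻¹ • m j| ≤ (2 * n) ^ n * η := by
    refine hunit _ fun j => ?_
    rw [norm_smul, norm_inv, norm_norm]
    exact inv_mul_le_one
  calc ‖A m‖ = ‖A fun j => ‖m j‖ • (‖m j‖⁻¹ • m j)‖ := by rw [← e]
    _ = (∏ j, ‖m j‖) * |A fun j => ‖m j‖⁻¹ • m j| := by
        rw [A.map_smul_univ (fun j => ‖m j‖) (fun j => ‖m j‖⁻¹ • m j), smul_eq_mul, norm_mul,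
          Real.norm_eq_abs, Real.norm_eq_abs, abs_of_nonneg (by positivity)]
    _ ≤ (2 * n) ^ n * η * ∏ j, ‖m j‖ := by
        rw [mul_comm]; gcongr

end Polarization

/-- One-dimensional sublevel estimate: if `g 0` has `i`-th derivative `g i ≥ c` on an interval and
`ε < c δ ^ i`, then `|g 0| ≤ ε` on a set of measure at most `(2 ^ (i + 1) - 2) δ`. -/
theorem volume_sublevel_le_of_le_iterated_deriv {ε : ℝ} (i : ℕ) :
    ∀ {I : Set ℝ} {g : ℕ → ℝ → ℝ} {c δ : ℝ}, Convex ℝ I → 0 < c → 0 < δ → ε < c * δ ^ i →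
      (∀ k < i, ∀ t ∈ I, HasDerivAt (g k) (g (k + 1) t) t) → (∀ t ∈ I, c ≤ g i t) →
      volume {t ∈ I | |g 0 t| ≤ ε} ≤ ENNReal.ofReal ((2 ^ (i + 1) - 2) * δ) := by
  induction i with
  | zero =>
    intro I g c δ _ _ _ hε _ hg
    have : {t ∈ I | |g 0 t| ≤ ε} = ∅ := by
      ext t
      simp only [Set.mem_ofPred_eq, Set.mem_empty_iff_false, iff_false, not_and, not_le]
      intro ht
      have := hg t ht
      have := le_abs_self (g 0 t)
      simp only [pow_zero, mul_one] at hε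
      linarith
    simp [this]
  | succ i ih =>
    intro I g c δ hI hc hδ hε hderiv hg
    have hd : ∀ t ∈ I, HasDerivAt (g i) (g (i + 1) t) t := hderiv i (Nat.lt_succ_self i)
    have hgrow : ∀ s ∈ I, ∀ t ∈ I, s ≤ t → c * (t - s) ≤ g i t - g i s :=
      hI.mul_sub_le_image_sub_of_le_deriv (fun t ht => (hd t ht).continuousAt.continuousWithinAt)
        (fun t ht => (hd t (interior_subset ht)).differentiableAt.differentiableWithinAt)
        (fun t ht => by
          rw [(hd t (interior_subset ht)).deriv]; exact hg t (interior_subset ht))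
    have hmono : MonotoneOn (g i) I := fun s hs t ht hst => by
      have := hgrow s hs t ht hst
      have := mul_nonneg hc.le (sub_nonneg.2 hst)
      linarith
    have hcδ : 0 < c * δ := mul_pos hc hδ
    have hε' : ε < c * δ * δ ^ i := by rw [mul_assoc, ← pow_succ']; exact hε
    have hpos := ih (g := g) (hmono.convex_ge hI (c * δ)) hcδ hδ hε'
      (fun k hk t ht => hderiv k (hk.trans (Nat.lt_succ_self i)) t ht.1) (fun t ht => ht.2)
    have hneg := ih (g := fun k t => -g k t) (hmono.convex_le hI (-(c * δ))) hcδ hδ hε'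
      (fun k hk t ht => (hderiv k (hk.trans (Nat.lt_succ_self i)) t ht.1).neg)
      (fun t ht => le_neg.1 ht.2)
    have hmid : volume {t ∈ I | |g i t| ≤ c * δ} ≤ ENNReal.ofReal (2 * δ) := by
      refine (Real.volume_le_diam _).trans (Metric.ediam_le fun s hs t ht => ?_)
      rw [edist_dist]
      apply ENNReal.ofReal_le_ofReal
      have hs2 := abs_le.1 hs.2
      have ht2 := abs_le.1 ht.2
      have key : c * |s - t| ≤ c * (2 * δ) := by
        rcases le_total s t with h | h
        · have := hgrow s hs.1 t ht.1 h
          rw [abs_of_nonpos (by linarith)]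
          linarith
        · have := hgrow t ht.1 s hs.1 h
          rw [abs_of_nonneg (by linarith)]
          linarith
      exact le_of_mul_le_mul_left key hc
    have hcover : {t ∈ I | |g 0 t| ≤ ε} ⊆
        {t ∈ I | |g i t| ≤ c * δ} ∪ ({t ∈ {t ∈ I | c * δ ≤ g i t} | |g 0 t| ≤ ε} ∪
          {t ∈ {t ∈ I | g i t ≤ -(c * δ)} | |-g 0 t| ≤ ε}) := by
      rintro t ⟨ht, htε⟩
      rcases le_total (|g i t|) (c * δ) with h | h
      · exact Or.inl ⟨ht, h⟩
      · rcases le_abs.1 h with h | h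
        · exact Or.inr (Or.inl ⟨⟨ht, h⟩, htε⟩)
        · exact Or.inr (Or.inr ⟨⟨ht, le_neg.1 h⟩, by rwa [abs_neg]⟩)
    have h2 : (2 : ℝ) ≤ 2 ^ (i + 1) := by
      simpa using pow_le_pow_right₀ (one_le_two : (1 : ℝ) ≤ 2) (Nat.le_add_left 1 i)
    have hnn : 0 ≤ ((2 : ℝ) ^ (i + 1) - 2) * δ := mul_nonneg (by linarith) hδ.le
    calc volume {t ∈ I | |g 0 t| ≤ ε} ≤ _ := measure_mono hcover
      _ ≤ _ := (measure_union_le _ _).trans (add_le_add_right (measure_union_le _ _) _)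
      _ ≤ ENNReal.ofReal (2 * δ) + (ENNReal.ofReal ((2 ^ (i + 1) - 2) * δ) +
          ENNReal.ofReal ((2 ^ (i + 1) - 2) * δ)) := add_le_add hmid (add_le_add hpos hneg)
      _ = ENNReal.ofReal ((2 ^ (i + 1 + 1) - 2) * δ) := by
        rw [← ENNReal.ofReal_add hnn hnn, ← ENNReal.ofReal_add (by positivity) (by positivity)]
        congr 1
        ring

/-- A bounded set whose sections along lines in direction `v` have length at most `L` has measure
controlled by `L`. -/
theorem measure_le_mul_of_volume_line_le {E : Type*} [NormedAddCommGroup E] [NormedSpace ℝ E]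
    [FiniteDimensional ℝ E] [MeasurableSpace E] [BorelSpace E] (μ : Measure E)
    [μ.IsAddHaarMeasure] {S : Set E} (hS : MeasurableSet S) {r : ℝ}
    (hSr : S ⊆ Metric.closedBall 0 r) {v : E} (hv : ‖v‖ ≤ 1) {L : ENNReal}
    (hL : ∀ x : E, volume {t : ℝ | x + t • v ∈ S} ≤ L) :
    μ S ≤ L * μ (Metric.closedBall 0 (r + 1)) := by
  have hmeas : Measurable fun p : ℝ × E => S.indicator (1 : E → ENNReal) (p.2 + p.1 • v) :=
    (measurable_one.indicator hS).comp (by fun_prop)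
  calc μ S = ∫⁻ _ in Set.Icc (0 : ℝ) 1, μ S := by simp
    _ ≤ ∫⁻ t in Set.Icc (0 : ℝ) 1, ∫⁻ x in Metric.closedBall 0 (r + 1),
          S.indicator 1 (x + t • v) ∂μ := by
        refine setLIntegral_mono' measurableSet_Icc fun t ht => ?_
        have hpre : MeasurableSet ((fun x : E => x + t • v) ⁻¹' S) :=
          (measurable_add_const _) hS
        have hsub : (fun x : E => x + t • v) ⁻¹' S ⊆ Metric.closedBall 0 (r + 1) := by
          intro x hx
          have h1 : ‖x + t • v‖ ≤ r := by simpa using hSr hx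
          have h2 : ‖t • v‖ ≤ 1 := by
            rw [norm_smul, Real.norm_eq_abs, abs_of_nonneg ht.1]
            exact mul_le_one₀ ht.2 (norm_nonneg _) hv
          have h3 : ‖x‖ ≤ ‖x + t • v‖ + ‖t • v‖ := by
            simpa using norm_sub_le (x + t • v) (t • v)
          simpa using h3.trans (add_le_add h1 h2)
        have e : (fun x : E => S.indicator (1 : E → ENNReal) (x + t • v)) =
            ((fun x : E => x + t • v) ⁻¹' S).indicator 1 := rfl
        rw [e, lintegral_indicator_one hpre, Measure.restrict_apply hpre,
          Set.inter_eq_left.2 hsub, measure_preimage_add_right]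
    _ = ∫⁻ x in Metric.closedBall 0 (r + 1), (∫⁻ t in Set.Icc (0 : ℝ) 1,
          S.indicator 1 (x + t • v)) ∂μ := by
        rw [lintegral_lintegral_swap hmeas.aemeasurable]
    _ ≤ ∫⁻ _ in Metric.closedBall 0 (r + 1), L ∂μ := by
        refine lintegral_mono fun x => ?_
        have hpre : MeasurableSet {t : ℝ | x + t • v ∈ S} :=
          (show Measurable fun t : ℝ => x + t • v by fun_prop) hS
        have e : (fun t : ℝ => S.indicator (1 : E → ENNReal) (x + t • v)) =
            {t : ℝ | x + t • v ∈ S}.indicator 1 := rfl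
        calc ∫⁻ t in Set.Icc (0 : ℝ) 1, S.indicator 1 (x + t • v)
            ≤ ∫⁻ t : ℝ, S.indicator 1 (x + t • v) := setLIntegral_le_lintegral _ _
          _ = volume {t : ℝ | x + t • v ∈ S} := by rw [e, lintegral_indicator_one hpre]
          _ ≤ L := hL x
    _ = L * μ (Metric.closedBall 0 (r + 1)) := by simp

/-- Sublevel estimate on a ball on which the `i`-th derivative of `Y` is almost constant and large. -/
theorem measure_le_of_norm_iteratedFDeriv {E : Type*} [NormedAddCommGroup E] [NormedSpace ℝ E]
    [FiniteDimensional ℝ E] [MeasurableSpace E] [BorelSpace E] (μ : Measure E)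
    [μ.IsAddHaarMeasure] {Y : E → ℝ} {i : ℕ} (hi : 1 ≤ i) {x₀ : E} {ρ M η ε δ r : ℝ}
    (hY : ∀ x ∈ Metric.closedBall x₀ ρ, ContDiffAt ℝ (i + 1) Y x)
    (hM : ∀ x ∈ Metric.closedBall x₀ ρ, ‖iteratedFDeriv ℝ (i + 1) Y x‖ ≤ M)
    (hρ : 0 ≤ ρ) (hη : 0 < η) (hMρ : M * ρ ≤ η / 2)
    (hx₀ : (2 * i) ^ i * η < ‖iteratedFDeriv ℝ i Y x₀‖) (hδ : 0 < δ) (hε : ε < η / 2 * δ ^ i)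
    {S : Set E} (hS : MeasurableSet S) (hSρ : S ⊆ Metric.closedBall x₀ ρ)
    (hSr : S ⊆ Metric.closedBall 0 r) (hSε : ∀ x ∈ S, |Y x| ≤ ε) :
    μ S ≤ ENNReal.ofReal (2 ^ (i + 1) * δ) * μ (Metric.closedBall 0 (r + 1)) := by
  have hx₀mem : x₀ ∈ Metric.closedBall x₀ ρ := Metric.mem_closedBall_self hρ
  obtain ⟨v, hv, hvη⟩ : ∃ v : E, ‖v‖ ≤ 1 ∧ η < |iteratedFDeriv ℝ i Y x₀ fun _ => v| := by
    by_contra! h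
    refine absurd hx₀ (not_lt.2 (ContinuousMultilinearMap.norm_le_of_diagonal_le hi _ ?_ h))
    exact ((hY x₀ hx₀mem).of_le (by norm_cast; omega)).iteratedFDeriv_comp_perm_of_le
  have hlip : ∀ y ∈ Metric.closedBall x₀ ρ,
      ‖iteratedFDeriv ℝ i Y y - iteratedFDeriv ℝ i Y x₀‖ ≤ η / 2 := by
    intro y hy
    have hM0 : 0 ≤ M := (norm_nonneg _).trans (hM x₀ hx₀mem)
    have h := (convex_closedBall x₀ ρ).norm_image_sub_le_of_norm_fderiv_le
      (f := iteratedFDeriv ℝ i Y) (𝕜 := ℝ) (C := M)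
      (fun x hx => (hY x hx).differentiableAt_iteratedFDeriv (by norm_cast; omega))
      (fun x hx => by rw [norm_fderiv_iteratedFDeriv]; exact hM x hx) hx₀mem hy
    exact (h.trans (mul_le_mul_of_nonneg_left (mem_closedBall_iff_norm.1 hy) hM0)).trans hMρ
  obtain ⟨σ, hσ, hσv⟩ : ∃ σ : ℝ, |σ| = 1 ∧ σ * (iteratedFDeriv ℝ i Y x₀ fun _ => v) =
      |iteratedFDeriv ℝ i Y x₀ fun _ => v| := by
    rcases le_total 0 (iteratedFDeriv ℝ i Y x₀ fun _ => v) with h | h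
    · exact ⟨1, by simp, by rw [abs_of_nonneg h, one_mul]⟩
    · exact ⟨-1, by simp, by rw [abs_of_nonpos h, neg_one_mul]⟩
  have hlow : ∀ y ∈ Metric.closedBall x₀ ρ, η / 2 ≤ σ * iteratedFDeriv ℝ i Y y fun _ => v := by
    intro y hy
    have h1 : |σ * ((iteratedFDeriv ℝ i Y y - iteratedFDeriv ℝ i Y x₀) fun _ => v)| ≤ η / 2 := by
      rw [abs_mul, hσ, one_mul, ← Real.norm_eq_abs]
      refine (ContinuousMultilinearMap.le_opNorm _ _).trans ?_
      refine (mul_le_of_le_one_right (norm_nonneg _) ?_).trans (hlip y hy)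
      exact Finset.prod_le_one (fun _ _ => norm_nonneg _) (fun _ _ => hv)
    have h2 := (abs_le.1 h1).1
    rw [sub_apply, mul_sub, hσv] at h2
    linarith
  refine measure_le_mul_of_volume_line_le μ hS hSr hv fun x => ?_
  have hline : ∀ t : ℝ, HasDerivAt (fun t : ℝ => x + t • v) v t := fun t => by
    simpa using ((hasDerivAt_id t).smul_const v).const_add x
  have hI : Convex ℝ {t : ℝ | x + t • v ∈ Metric.closedBall x₀ ρ} := by
    intro s hs t ht a b ha hb hab
    have e : x + (a • s + b • t) • v = a • (x + s • v) + b • (x + t • v) := by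
      obtain rfl : b = 1 - a := by linarith
      simp only [smul_eq_mul]
      module
    change x + (a • s + b • t) • v ∈ Metric.closedBall x₀ ρ
    rw [e]
    exact convex_closedBall x₀ ρ hs ht ha hb hab
  have h1d := volume_sublevel_le_of_le_iterated_deriv (ε := ε) i
    (g := fun k t => σ * iteratedFDeriv ℝ k Y (x + t • v) fun _ => v) hI (half_pos hη) hδ hε
    (fun k hk t ht => by
      have hd : DifferentiableAt ℝ (iteratedFDeriv ℝ k Y) (x + t • v) :=
        (hY _ ht).differentiableAt_iteratedFDeriv (by norm_cast; omega)
      exact ((ContinuousMultilinearMap.apply ℝ (fun _ : Fin k => E) ℝ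
        fun _ => v).hasFDerivAt.comp_hasDerivAt t
          (hd.hasFDerivAt.comp_hasDerivAt t (hline t))).const_mul σ)
    (fun t ht => hlow _ ht)
  refine (measure_mono ?_).trans (h1d.trans (ENNReal.ofReal_le_ofReal ?_))
  · intro t ht
    refine ⟨hSρ ht, ?_⟩
    rw [abs_mul, hσ, one_mul, iteratedFDeriv_zero_apply]
    exact hSε _ ht
  · gcongr
    linarith

/-- sublevel-set estimate: if some derivative of `Y` of order
`≤ q` is bounded below on a compact set `K ⊆ B_R` and `∇Y ∈ C^q(B_{R+1})` with
norm `≤ M`, then `|{x ∈ K : |Y(x)| ≤ ε}| ≤ C(n,q,R,M)·ε^{1/q}`. -/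
theorem stmt19 (n q : ℕ) (hn : 0 < n) (hq : 1 ≤ q) (R M : ℝ) (hR : 0 < R) (hM : 0 < M) :
    ∃ C > (0 : ℝ), ∀ (Y : EuclideanSpace ℝ (Fin n) → ℝ)
      (K : Set (EuclideanSpace ℝ (Fin n))),
      IsCompact K → K ⊆ Metric.closedBall 0 R →
      ContDiffOn ℝ (q + 1) Y (Metric.closedBall 0 (R + 1)) →
      (∀ i : ℕ, 1 ≤ i → i ≤ q + 1 → ∀ x ∈ Metric.closedBall (0 : EuclideanSpace ℝ (Fin n)) (R + 1),
        ‖iteratedFDeriv ℝ i Y x‖ ≤ M) →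
      (∀ x ∈ K, 1 ≤ ∑ i ∈ Finset.range (q + 1), ‖iteratedFDeriv ℝ i Y x‖) →
      ∀ ε ∈ Set.Ioc (0 : ℝ) 1,
        volume {x ∈ K | |Y x| ≤ ε} ≤ ENNReal.ofReal (C * ε ^ (1 / (q : ℝ))) := by
  set V : ℝ := (volume (Metric.closedBall (0 : EuclideanSpace ℝ (Fin n)) (R + 1))).toReal with hV
  have hVtop : volume (Metric.closedBall (0 : EuclideanSpace ℝ (Fin n)) (R + 1)) ≠ ⊤ :=
    measure_closedBall_lt_top.ne
  have hV0 : 0 ≤ V := ENNReal.toReal_nonneg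
  have hq0 : (0 : ℝ) < q := by exact_mod_cast hq
  obtain ⟨η, hη, hηq⟩ : ∃ η : ℝ, 0 < η ∧ (2 * q : ℝ) ^ q * η < 1 / (q + 1) := by
    refine ⟨1 / (q + 1) / (2 * (2 * q) ^ q), by positivity, ?_⟩
    have h1 : (0 : ℝ) < 1 / (q + 1) := by positivity
    have h2 : (0 : ℝ) < (2 * q) ^ q := by positivity
    calc (2 * q : ℝ) ^ q * (1 / (q + 1) / (2 * (2 * q) ^ q)) = 1 / (q + 1) / 2 := by field_simp
      _ < 1 / (q + 1) := half_lt_self h1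
  obtain ⟨ρ, hρ, hρ1, hMρ⟩ : ∃ ρ : ℝ, 0 < ρ ∧ ρ < 1 ∧ M * ρ ≤ η / 2 := by
    refine ⟨min (1 / 2) (η / 2 / M), by positivity, (min_le_left _ _).trans_lt (by norm_num), ?_⟩
    calc M * min (1 / 2) (η / 2 / M) ≤ M * (η / 2 / M) := by gcongr; exact min_le_right _ _
      _ = η / 2 := by field_simp
  obtain ⟨D, hD1, hDη⟩ : ∃ D : ℝ, 1 ≤ D ∧ 1 < η / 2 * D := by
    refine ⟨2 / η + 1, by simp; positivity, ?_⟩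
    have : η / 2 * (2 / η + 1) = 1 + η / 2 := by field_simp
    linarith
  obtain ⟨T, -, hTfin, hT⟩ :=
    (isCompact_closedBall (0 : EuclideanSpace ℝ (Fin n)) R).finite_cover_balls (half_pos hρ)
  obtain ⟨T, rfl⟩ := hTfin.exists_finset_coe
  refine ⟨T.card * (2 ^ (q + 1) * D * V) + (q + 1) * V + 1, by positivity, ?_⟩
  intro Y K hK hKR hY hYM hYK ε hε
  set E := ε ^ (1 / (q : ℝ)) with hE
  have hE0 : 0 < E := Real.rpow_pos_of_pos hε.1 _
  have hE1 : E ≤ 1 := Real.rpow_le_one hε.1.le hε.2 (by positivity)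
  have hEq : E ^ q = ε := by
    rw [hE, one_div, Real.rpow_inv_natCast_pow hε.1.le (by omega)]
  rcases le_or_gt (1 / (q + 1 : ℝ)) ε with hlarge | hsmall
  · have hεE : ε ≤ E := by
      rw [← hEq]; exact pow_le_of_le_one hE0.le hE1 (by omega)
    calc volume {x ∈ K | |Y x| ≤ ε}
        ≤ volume (Metric.closedBall (0 : EuclideanSpace ℝ (Fin n)) (R + 1)) :=
          measure_mono fun x hx => Metric.closedBall_subset_closedBall (by linarith) (hKR hx.1)
      _ = ENNReal.ofReal V := (ENNReal.ofReal_toReal hVtop).symm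
      _ ≤ _ := by
          apply ENNReal.ofReal_le_ofReal
          have h1 : 1 ≤ (q + 1) * E := by
            rw [div_le_iff₀ (by positivity)] at hlarge
            nlinarith
          have h2 : V ≤ (q + 1) * V * E := by nlinarith
          have h3 : 0 ≤ (T.card * (2 ^ (q + 1) * D * V) + 1) * E := by positivity
          linarith
  · have hSmeas : MeasurableSet {x ∈ K | |Y x| ≤ ε} := by
      have hYK' : ContinuousOn (fun x => |Y x|) K := (hY.continuousOn.mono (hKR.trans
        (Metric.closedBall_subset_closedBall (by linarith)))).abs
      exact (hYK'.preimage_isClosed_of_isClosed hK.isClosed isClosed_Iic).measurableSet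
    have hlocal : ∀ p ∈ T, volume ({x ∈ K | |Y x| ≤ ε} ∩ Metric.closedBall p (ρ / 2)) ≤
        ENNReal.ofReal (2 ^ (q + 1) * (D * E) * V) := by
      intro p _
      rcases ({x ∈ K | |Y x| ≤ ε} ∩ Metric.closedBall p (ρ / 2)).eq_empty_or_nonempty with
        he | ⟨x₀, ⟨hx₀K, hx₀ε⟩, hx₀p⟩
      · simp [he]
      obtain ⟨i, hi, hix⟩ : ∃ i ∈ Finset.range (q + 1),
          1 / (q + 1 : ℝ) ≤ ‖iteratedFDeriv ℝ i Y x₀‖ := by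
        refine Finset.exists_le_of_sum_le (by simp) ?_
        refine le_trans (le_of_eq ?_) (hYK x₀ hx₀K)
        simp only [Finset.sum_const, Finset.card_range, nsmul_eq_mul]
        push_cast
        field_simp
      have hiq : i ≤ q := Nat.lt_succ_iff.1 (Finset.mem_range.1 hi)
      have hi1 : 1 ≤ i := by
        by_contra! h
        obtain rfl : i = 0 := by omega
        rw [norm_iteratedFDeriv_zero, Real.norm_eq_abs] at hix
        linarith
      have hsub : Metric.closedBall x₀ ρ ⊆ Metric.ball 0 (R + 1) := by
        refine Metric.closedBall_subset_ball' ?_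
        have := Metric.mem_closedBall.1 (hKR hx₀K)
        linarith
      have hpow : (2 * i : ℝ) ^ i ≤ (2 * q) ^ q := by
        have h1 : (1 : ℝ) ≤ 2 * q := by
          have : (1 : ℝ) ≤ q := by exact_mod_cast hq
          linarith
        calc (2 * i : ℝ) ^ i ≤ (2 * q) ^ i := by gcongr
          _ ≤ (2 * q) ^ q := pow_le_pow_right₀ h1 hiq
      have hloc := measure_le_of_norm_iteratedFDeriv (volume : Measure (EuclideanSpace ℝ (Fin n)))
        (Y := Y) hi1 (x₀ := x₀) (ρ := ρ) (M := M) (η := η) (ε := ε) (δ := D * E) (r := R)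
        (S := {x ∈ K | |Y x| ≤ ε} ∩ Metric.closedBall p (ρ / 2))
        (fun x hx => (hY.contDiffAt (Filter.mem_of_superset
          (Metric.isOpen_ball.mem_nhds (hsub hx)) Metric.ball_subset_closedBall)).of_le
          (by norm_cast; omega))
        (fun x hx => hYM (i + 1) (by omega) (by omega) x (Metric.ball_subset_closedBall (hsub hx)))
        hρ.le hη hMρ
        (((mul_le_mul_of_nonneg_right hpow hη.le).trans_lt hηq).trans_le hix)
        (by positivity)
        (by
          have h1 : D ≤ D ^ i := le_self_pow₀ hD1 (by omega)
          have h2 : ε ≤ E ^ i := hEq ▸ pow_le_pow_of_le_one hE0.le hE1 hiq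
          calc ε < η / 2 * D * ε := lt_mul_left hε.1 hDη
            _ = η / 2 * (D * ε) := by ring
            _ ≤ η / 2 * (D ^ i * E ^ i) := by
                have := hε.1
                gcongr
            _ = η / 2 * (D * E) ^ i := by rw [mul_pow])
        (hSmeas.inter Metric.isClosed_closedBall.measurableSet)
        (fun x hx => Metric.mem_closedBall.2 <| by
          have h1 := Metric.mem_closedBall.1 hx.2
          have h2 := Metric.mem_closedBall.1 hx₀p
          have h3 := dist_triangle_right x x₀ p
          linarith)
        (fun x hx => hKR hx.1.1) (fun x hx => hx.1.2)
      refine hloc.trans ?_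
      rw [← ENNReal.ofReal_toReal hVtop, ← hV, ← ENNReal.ofReal_mul (by positivity)]
      apply ENNReal.ofReal_le_ofReal
      gcongr
      norm_num
    have hcover : {x ∈ K | |Y x| ≤ ε} ⊆
        ⋃ p ∈ T, {x ∈ K | |Y x| ≤ ε} ∩ Metric.closedBall p (ρ / 2) := by
      intro x hx
      obtain ⟨p, hp, hxp⟩ := Set.mem_iUnion₂.1 (hT (hKR hx.1))
      exact Set.mem_iUnion₂.2 ⟨p, hp, hx, Metric.ball_subset_closedBall hxp⟩
    calc volume {x ∈ K | |Y x| ≤ ε} ≤ _ := measure_mono hcover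
      _ ≤ ∑ p ∈ T, volume ({x ∈ K | |Y x| ≤ ε} ∩ Metric.closedBall p (ρ / 2)) :=
          measure_biUnion_finset_le _ _
      _ ≤ ∑ p ∈ T, ENNReal.ofReal (2 ^ (q + 1) * (D * E) * V) := Finset.sum_le_sum hlocal
      _ = ENNReal.ofReal (T.card * (2 ^ (q + 1) * (D * E) * V)) := by
          rw [Finset.sum_const, nsmul_eq_mul,
            ENNReal.ofReal_mul (p := (T.card : ℝ)) (by positivity),
            ENNReal.ofReal_natCast]
      _ ≤ _ := by
          apply ENNReal.ofReal_le_ofReal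
          have h3 : 0 ≤ ((q + 1) * V + 1) * E := by positivity
          linarith
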